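/- arXiv:2603.10073 — 5 statements merged into one kernel-verified Lean document; each statement's English description precedes it below -/
import Mathlib

section
/- Let 𝒴 be a finite set, y₀ ≠ y₁ elements of 𝒴, W₀ and W₁ probability mass functions on 𝒴, n ≥ 1, 0 ≤ k ≤ n−1, π ∈ [0,1], and nonnegative reals α₀(y) for y ≠ y₀ and α₁(y) for y ≠ y₁. Let N⁽⁰⁾ ~ Multinomial(n−k, W₀) and N⁽¹⁾ ~ Multinomial(k, W₁) be independent, and set H := N⁽⁰⁾ + N⁽¹⁾ − (n−k)e_{y₀} − k e_{y₁} ∈ ℤ^𝒴, where e_y is the standard basis vector. Let H_∞ := ∑_{y ≠ y₀} U_y (e_y − e_{y₀}) + ∑_{y ≠ y₁} V_y (e_y − e_{y₁}), where all U_y ~ Poisson((1−π)α₀(y)) and V_y ~ Poisson(πα₁(y)) are mutually independent. Let p₀ := 1 − W₀(y₀) and p₁ := 1 − W₁(y₁). Then TV(law(H), law(H_∞)) ≤ (n−k)p₀(1 − e^{−p₀}) + k p₁(1 − e^{−p₁}) + ∑_{y ≠ y₀} |(n−k)W₀(y) − (1−π)α₀(y)| + ∑_{y ≠ y₁} |k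 W₁(y) − πα₁(y)|. The analogous bound holds for the neighboring composition: if N⁽⁰⁾' ~ Multinomial(n−k−1, W₀) and N⁽¹⁾' ~ Multinomial(k+1, W₁) are independent and H' := N⁽⁰⁾' + N⁽¹⁾' − (n−k−1)e_{y₀} − (k+1)e_{y₁}, then TV(law(H'), law(H_∞)) ≤ (n−k−1)p₀(1 − e^{−p₀}) + (k+1)p₁(1 − e^{−p₁}) + ∑_{y ≠ y₀} |(n−k−1)W₀(y) − (1−π)α₀(y)| + ∑_{y ≠ y₁} |(k+1)W₁(y) − πα₁(y)|. -/
open MeasureTheory Filter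

/-- Total variation distance `TV(μ,ν) = sup_A |μ(A) - ν(A)|`. -/
noncomputable def tvDist {Ω : Type*} [MeasurableSpace Ω] (μ ν : Measure Ω) : ℝ :=
  ⨆ A : {s : Set Ω // MeasurableSet s}, |(μ A.1).toReal - (ν A.1).toReal|

/-- Poisson(l) probability mass function on ℕ. -/
noncomputable def poisPMF (l : ℝ) (k : ℕ) : ℝ :=
  Real.exp (-l) * l ^ k / (k.factorial : ℝ)

/-- Multinomial(m,W) pmf on count vectors over a finite alphabet. -/
noncomputable def multinomialPMF {Y : Type*} [Fintype Y] (m : ℕ) (W : Y → ℝ) (h : Y → ℕ) : ℝ :=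
  if ∑ y, h y = m then (Nat.multinomial Finset.univ h : ℝ) * ∏ y, W y ^ h y else 0

section Abstract

variable {A : Type*} [NormedCommRing A] [NormedAlgebra ℝ A] [CompleteSpace A]

theorem aux_exp_add (x y : A) :
    NormedSpace.exp (x + y) = NormedSpace.exp x * NormedSpace.exp y := by
  let _ : NormedAlgebra ℚ A := NormedAlgebra.restrictScalars ℚ ℝ A
  exact NormedSpace.exp_add

theorem aux_exp_nsmul (n : ℕ) (x : A) :
    NormedSpace.exp (n • x) = NormedSpace.exp x ^ n := by
  let _ : NormedAlgebra ℚ A := NormedAlgebra.restrictScalars ℚ ℝ A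
  exact NormedSpace.exp_nsmul n x

theorem aux_exp_smul_one (r : ℝ) :
    NormedSpace.exp (r • (1 : A)) = Real.exp r • (1 : A) := by
  have := NormedSpace.algebraMap_exp_comm (𝕂 := ℝ) (𝔸 := A) r
  rw [Algebra.algebraMap_eq_smul_one, Algebra.algebraMap_eq_smul_one] at this
  rw [← this, Real.exp_eq_exp_ℝ]

theorem aux_exp_sub (C : A) (c : ℝ) :
    NormedSpace.exp (C - c • (1 : A)) = Real.exp (-c) • NormedSpace.exp C := by
  rw [sub_eq_add_neg, ← neg_smul, aux_exp_add, aux_exp_smul_one]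
  simp

theorem aux_exp_tail1 (C : A) (c : ℝ) (hC : ‖C‖ ≤ c) :
    ‖NormedSpace.exp C - 1‖ ≤ Real.exp c - 1 := by
  have h := NormedSpace.exp_series_hasSum_exp' (𝕂 := ℝ) C
  have h2 := (hasSum_nat_add_iff' 1).2 h
  have g := NormedSpace.exp_series_hasSum_exp' (𝕂 := ℝ) c
  have g2 := (hasSum_nat_add_iff' 1).2 g
  rw [← Real.exp_eq_exp_ℝ] at g2
  simp only [Finset.sum_range_one, Nat.factorial_zero, pow_zero, Nat.cast_one, inv_one, one_smul] at h2 g2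
  rw [← h2.tsum_eq, ← g2.tsum_eq]
  refine tsum_of_norm_bounded g2.summable.hasSum ?_
  intro i
  rw [norm_smul, smul_eq_mul, Real.norm_of_nonneg (by positivity)]
  gcongr
  exact (norm_pow_le' _ (by omega)).trans (by gcongr)

theorem aux_exp_tail2 (C : A) (c : ℝ) (hC : ‖C‖ ≤ c) :
    ‖NormedSpace.exp C - (1 + C)‖ ≤ Real.exp c - (1 + c) := by
  have h := NormedSpace.exp_series_hasSum_exp' (𝕂 := ℝ) C
  have h2 := (hasSum_nat_add_iff' 2).2 h
  have g := NormedSpace.exp_series_hasSum_exp' (𝕂 := ℝ) c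
  have g2 := (hasSum_nat_add_iff' 2).2 g
  rw [← Real.exp_eq_exp_ℝ] at g2
  simp only [Finset.sum_range_succ, Finset.sum_range_zero, zero_add, Nat.factorial_one, pow_one,
    Nat.factorial_zero, pow_zero, Nat.cast_one, inv_one, one_smul] at h2 g2
  rw [← h2.tsum_eq, ← g2.tsum_eq]
  refine tsum_of_norm_bounded g2.summable.hasSum ?_
  intro i
  rw [norm_smul, smul_eq_mul, Real.norm_of_nonneg (by positivity)]
  gcongr
  exact (norm_pow_le' _ (by omega)).trans (by gcongr)

/-- the one-trial Le Cam estimate -/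
theorem aux_lecam_one (h1 : ‖(1 : A)‖ ≤ 1) (C : A) (c : ℝ) (hC : ‖C‖ ≤ c) :
    ‖(1 + (C - c • (1 : A))) - NormedSpace.exp (C - c • (1 : A))‖
      ≤ 2 * (c * (1 - Real.exp (-c))) := by
  have hc : 0 ≤ c := (norm_nonneg _).trans hC
  rw [aux_exp_sub]
  set e := Real.exp (-c) with he
  have he1 : e ≤ 1 := by rw [he]; exact Real.exp_le_one_iff.2 (by linarith)
  have he0 : 0 < e := Real.exp_pos _
  have hee : e * Real.exp c = 1 := by rw [he, ← Real.exp_add]; simp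
  have he2 : 1 - c ≤ e := by have := Real.add_one_le_exp (-c); linarith
  have key : (1 + (C - c • (1 : A))) - e • NormedSpace.exp C
      = (1 - c - e) • (1 : A) + (1 - e) • C - e • (NormedSpace.exp C - (1 + C)) := by
    module
  rw [key]
  calc _ ≤ ‖(1 - c - e) • (1 : A)‖ + ‖(1 - e) • C‖ + ‖e • (NormedSpace.exp C - (1 + C))‖ :=
        (norm_sub_le _ _).trans (by gcongr; exact norm_add_le _ _)
    _ ≤ (e - (1 - c)) * 1 + (1 - e) * c + e * (Real.exp c - (1 + c)) := by
        rw [norm_smul, norm_smul, norm_smul, Real.norm_of_nonpos (by linarith),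
          Real.norm_of_nonneg (by linarith : 0 ≤ 1 - e), Real.norm_of_nonneg he0.le]
        have := aux_exp_tail2 C c hC
        have h3 : 0 ≤ 1 - e := by linarith
        have h4 : 0 ≤ e - (1 - c) := by linarith
        rw [show -(1 - c - e) = e - (1 - c) by ring]
        gcongr
    _ = _ := by linear_combination hee

theorem aux_exp_sub_one (h1 : ‖(1 : A)‖ ≤ 1) (C : A) (c : ℝ) (hC : ‖C‖ ≤ c) :
    ‖NormedSpace.exp (C - c • (1 : A)) - 1‖ ≤ 2 * c := by
  have hc : 0 ≤ c := (norm_nonneg _).trans hC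
  rw [aux_exp_sub]
  set e := Real.exp (-c) with he
  have he1 : e ≤ 1 := by rw [he]; exact Real.exp_le_one_iff.2 (by linarith)
  have he0 : 0 < e := Real.exp_pos _
  have hee : e * Real.exp c = 1 := by rw [he, ← Real.exp_add]; simp
  have he2 : 1 - c ≤ e := by have := Real.add_one_le_exp (-c); linarith
  have key : e • NormedSpace.exp C - 1
      = e • (NormedSpace.exp C - 1) - (1 - e) • (1 : A) := by
    module
  rw [key]
  calc _ ≤ ‖e • (NormedSpace.exp C - 1)‖ + ‖(1 - e) • (1 : A)‖ := norm_sub_le _ _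
    _ ≤ e * (Real.exp c - 1) + (1 - e) * 1 := by
        rw [norm_smul, norm_smul, 
          Real.norm_of_nonneg (by linarith : 0 ≤ 1 - e), Real.norm_of_nonneg he0.le]
        have := aux_exp_tail1 C c hC
        have h3 : 0 ≤ 1 - e := by linarith
        gcongr
    _ ≤ _ := by linarith

theorem aux_exp_contr (h1 : ‖(1 : A)‖ ≤ 1) (C : A) (c : ℝ) (hC : ‖C‖ ≤ c) :
    ‖NormedSpace.exp (C - c • (1 : A))‖ ≤ 1 := by
  rw [aux_exp_sub, norm_smul, Real.norm_of_nonneg (Real.exp_pos _).le]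
  have h := aux_exp_tail1 C c hC
  have h2 : ‖NormedSpace.exp C‖ ≤ Real.exp c := by
    calc _ = ‖(NormedSpace.exp C - 1) + 1‖ := by simp
      _ ≤ _ := (norm_add_le _ _).trans (by linarith)
  calc _ ≤ Real.exp (-c) * Real.exp c := by gcongr
    _ = 1 := by rw [← Real.exp_add]; simp

theorem aux_mul_diff {x y x' y' : A} (hy : ‖y‖ ≤ 1) (hx' : ‖x'‖ ≤ 1) :
    ‖x * y - x' * y'‖ ≤ ‖x - x'‖ + ‖y - y'‖ := by
  have : x * y - x' * y' = (x - x') * y + x' * (y - y') := by ring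
  rw [this]
  refine (norm_add_le _ _).trans (add_le_add ((norm_mul_le _ _).trans ?_)
    ((norm_mul_le _ _).trans ?_))
  · exact mul_le_of_le_one_right (norm_nonneg _) hy
  · exact mul_le_of_le_one_left (norm_nonneg _) hx'

theorem aux_pow_contr (h1 : ‖(1 : A)‖ ≤ 1) {x : A} (hx : ‖x‖ ≤ 1) (m : ℕ) : ‖x ^ m‖ ≤ 1 := by
  induction m with
  | zero => simpa using h1
  | succ m ih =>
    rw [pow_succ]
    exact (norm_mul_le _ _).trans (mul_le_one₀ ih (norm_nonneg _) hx)

theorem aux_pow_diff (h1 : ‖(1 : A)‖ ≤ 1) {x y : A} (hx : ‖x‖ ≤ 1) (hy : ‖y‖ ≤ 1) (m : ℕ) :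
    ‖x ^ m - y ^ m‖ ≤ m * ‖x - y‖ := by
  induction m with
  | zero => simp
  | succ m ih =>
    rw [pow_succ, pow_succ]
    refine (aux_mul_diff hx (aux_pow_contr h1 hy m)).trans ?_
    push_cast
    linarith

theorem aux_norm_sum {ι : Type*} (s : Finset ι) (S : ι → A) (hS : ∀ i, ‖S i‖ ≤ 1) (a : ι → ℝ)
    (ha : ∀ i ∈ s, 0 ≤ a i) : ‖∑ i ∈ s, a i • S i‖ ≤ ∑ i ∈ s, a i := by
  refine norm_sum_le_of_le _ fun i hi => ?_
  rw [norm_smul, Real.norm_of_nonneg (ha i hi)]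
  exact mul_le_of_le_one_right (ha i hi) (hS i)

theorem aux_sum_sub {ι : Type*} (s : Finset ι) (S : ι → A) (a : ι → ℝ) :
    ∑ i ∈ s, a i • (S i - 1) = (∑ i ∈ s, a i • S i) - (∑ i ∈ s, a i) • (1 : A) := by
  simp [smul_sub, Finset.sum_sub_distrib, Finset.sum_smul]

theorem aux_pois_single (h1 : ‖(1 : A)‖ ≤ 1) (S : A) (hS : ‖S‖ ≤ 1) (a b : ℝ)
    (ha : 0 ≤ a) (hb : 0 ≤ b) :
    ‖NormedSpace.exp (a • (S - 1)) - NormedSpace.exp (b • (S - 1))‖ ≤ 2 * |a - b| := by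
  wlog hab : a ≤ b generalizing a b
  · rw [norm_sub_rev, abs_sub_comm]
    exact this b a hb ha (le_of_not_ge hab)
  have hn : ∀ c : ℝ, 0 ≤ c → ‖c • S‖ ≤ c := fun c hc => by
    rw [norm_smul, Real.norm_of_nonneg hc]
    exact mul_le_of_le_one_right hc hS
  have e1 : b • (S - 1) = a • (S - 1) + ((b - a) • S - (b - a) • (1 : A)) := by module
  have e2 : NormedSpace.exp (a • (S - 1)) - NormedSpace.exp (b • (S - 1))
      = NormedSpace.exp (a • S - a • (1 : A)) *
        -(NormedSpace.exp ((b - a) • S - (b - a) • (1 : A)) - 1) := by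
    rw [e1, aux_exp_add, smul_sub a]; ring
  rw [e2, abs_sub_comm, abs_of_nonneg (sub_nonneg.2 hab)]
  refine (norm_mul_le _ _).trans ?_
  rw [norm_neg]
  calc _ ≤ 1 * (2 * (b - a)) := by
        gcongr
        · exact aux_exp_contr h1 _ _ (hn _ ha)
        · exact aux_exp_sub_one h1 _ _ (hn _ (sub_nonneg.2 hab))
    _ = _ := by ring

theorem aux_pois_multi {ι : Type*} (h1 : ‖(1 : A)‖ ≤ 1) (s : Finset ι) (S : ι → A)
    (hS : ∀ i, ‖S i‖ ≤ 1) (a b : ι → ℝ)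
    (ha : ∀ i ∈ s, 0 ≤ a i) (hb : ∀ i ∈ s, 0 ≤ b i) :
    ‖NormedSpace.exp (∑ i ∈ s, a i • (S i - 1)) - NormedSpace.exp (∑ i ∈ s, b i • (S i - 1))‖
      ≤ 2 * ∑ i ∈ s, |a i - b i| := by
  classical
  induction s using Finset.induction_on with
  | empty => simp
  | insert i s hi ih =>
    rw [Finset.sum_insert hi, Finset.sum_insert hi, Finset.sum_insert hi, aux_exp_add, aux_exp_add]
    have ha' : ∀ i ∈ s, 0 ≤ a i := fun j hj => ha j (Finset.mem_insert_of_mem hj)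
    have hb' : ∀ i ∈ s, 0 ≤ b i := fun j hj => hb j (Finset.mem_insert_of_mem hj)
    have hai := ha i (Finset.mem_insert_self _ _)
    have hbi := hb i (Finset.mem_insert_self _ _)
    refine (aux_mul_diff ?_ ?_).trans ?_
    · rw [aux_sum_sub]
      exact aux_exp_contr h1 _ _ (aux_norm_sum s S hS a ha')
    · rw [smul_sub]
      refine aux_exp_contr h1 _ _ ?_
      rw [norm_smul, Real.norm_of_nonneg hbi]
      exact mul_le_of_le_one_right hbi (hS i)
    · have := ih ha' hb'
      have := aux_pois_single h1 (S i) (hS i) (a i) (b i) hai hbi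
      linarith

/-- combined estimate for one block -/
theorem aux_block {ι : Type*} (h1 : ‖(1 : A)‖ ≤ 1) (s : Finset ι) (S : ι → A)
    (hS : ∀ i, ‖S i‖ ≤ 1) (w l : ι → ℝ) (hw : ∀ i ∈ s, 0 ≤ w i) (hws : ∑ i ∈ s, w i ≤ 1)
    (hl : ∀ i ∈ s, 0 ≤ l i) (m : ℕ) :
    ‖(1 + ∑ i ∈ s, w i • (S i - 1)) ^ m - NormedSpace.exp (∑ i ∈ s, l i • (S i - 1))‖
      ≤ 2 * (m * (∑ i ∈ s, w i) * (1 - Real.exp (-(∑ i ∈ s, w i)))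
        + ∑ i ∈ s, |m * w i - l i|) := by
  have hC := aux_norm_sum s S hS w hw
  have e1 : NormedSpace.exp (∑ i ∈ s, (m * w i) • (S i - 1))
      = NormedSpace.exp (∑ i ∈ s, w i • (S i - 1)) ^ m := by
    rw [← aux_exp_nsmul, Finset.smul_sum]
    congr 1
    refine Finset.sum_congr rfl fun i _ => ?_
    rw [mul_smul, Nat.cast_smul_eq_nsmul]
  have hmw : ∀ i ∈ s, 0 ≤ (m : ℝ) * w i := fun i hi => mul_nonneg (Nat.cast_nonneg _) (hw i hi)
  have b1 := aux_pois_multi h1 s S hS (fun i => m * w i) l hmw hl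
  rw [e1] at b1
  have b2 : ‖(1 + ∑ i ∈ s, w i • (S i - 1))‖ ≤ 1 := by
    rw [aux_sum_sub]
    set c := ∑ i ∈ s, w i
    have : (1 : A) + (∑ i ∈ s, w i • S i - c • (1 : A)) = (1 - c) • (1 : A) + ∑ i ∈ s, w i • S i := by
      module
    rw [this]
    refine (norm_add_le _ _).trans ?_
    rw [norm_smul, Real.norm_of_nonneg (by linarith)]
    have : (1 - c) * ‖(1 : A)‖ ≤ (1 - c) * 1 := by
      have : 0 ≤ 1 - c := by linarith
      gcongr
    linarith
  have b3 : ‖NormedSpace.exp (∑ i ∈ s, w i • (S i - 1))‖ ≤ 1 := by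
    rw [aux_sum_sub]
    exact aux_exp_contr h1 _ _ hC
  have b4 := aux_pow_diff h1 b2 b3 m
  have b5 : ‖(1 + ∑ i ∈ s, w i • (S i - 1)) - NormedSpace.exp (∑ i ∈ s, w i • (S i - 1))‖
      ≤ 2 * ((∑ i ∈ s, w i) * (1 - Real.exp (-(∑ i ∈ s, w i)))) := by
    rw [aux_sum_sub]
    exact aux_lecam_one h1 _ _ hC
  have b6 := (norm_sub_le_norm_sub_add_norm_sub
    ((1 + ∑ i ∈ s, w i • (S i - 1)) ^ m) (NormedSpace.exp (∑ i ∈ s, w i • (S i - 1)) ^ m)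
    (NormedSpace.exp (∑ i ∈ s, l i • (S i - 1))))
  have b7 := mul_le_mul_of_nonneg_left b5 (Nat.cast_nonneg (α := ℝ) m)
  linarith

end Abstract
section Representation

theorem HasSum.aux_congr {Q M : Type*} [AddCommMonoid M] [TopologicalSpace M] {f g : Q → M} {a : M}
    (h : HasSum f a) (hfg : ∀ q, g q = f q) : HasSum g a := by
  rwa [show g = f from funext hfg]

theorem aux_hasSum_mul {Q Q' R : Type*} [NormedRing R] [CompleteSpace R] {f : Q → R} {g : Q' → R}
    {a b : R} (hf : HasSum f a) (hg : HasSum g b) (nf : Summable fun q => ‖f q‖)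
    (ng : Summable fun q => ‖g q‖) : HasSum (fun q : Q × Q' => f q.1 * g q.2) (a * b) := by
  have h1 := (summable_mul_of_summable_norm nf ng).hasSum
  rwa [← tsum_mul_tsum_of_summable_norm nf ng, hf.tsum_eq, hg.tsum_eq] at h1

variable {A : Type*} [NormedCommRing A] [NormedAlgebra ℝ A] [CompleteSpace A]
variable {G : Type*} [AddCommGroup G]

/-- `T` is the "convolution operator" of the law of `φ` under the pmf `w`. -/
structure AuxRep {Q : Type*} (S : G → A) (w : Q → ℝ) (φ : Q → G) (T : A) : Prop where
  nonneg : ∀ q, 0 ≤ w q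
  tot : HasSum w 1
  rep : HasSum (fun q => w q • S (φ q)) T

theorem AuxRep.norm_le {Q : Type*} {S : G → A} {w : Q → ℝ} {φ : Q → G} {T : A}
    (hS : ∀ g, ‖S g‖ ≤ 1) (h : AuxRep S w φ T) : ‖T‖ ≤ 1 := by
  rw [← h.rep.tsum_eq]
  refine tsum_of_norm_bounded h.tot fun q => ?_
  rw [norm_smul, Real.norm_of_nonneg (h.nonneg q)]
  exact mul_le_of_le_one_right (h.nonneg q) (hS _)

theorem AuxRep.mul {Q Q' : Type*} {S : G → A} {w : Q → ℝ} {φ : Q → G} {T : A}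
    {w' : Q' → ℝ} {φ' : Q' → G} {T' : A} (hS : ∀ g, ‖S g‖ ≤ 1)
    (hadd : ∀ a b, S (a + b) = S a * S b)
    (h : AuxRep S w φ T) (h' : AuxRep S w' φ' T') :
    AuxRep S (fun q : Q × Q' => w q.1 * w' q.2) (fun q => φ q.1 + φ' q.2) (T * T') := by
  have n1 : Summable fun q => ‖w q • S (φ q)‖ := by
    refine h.tot.summable.of_nonneg_of_le (fun _ => norm_nonneg _) fun q => ?_
    rw [norm_smul, Real.norm_of_nonneg (h.nonneg q)]
    exact mul_le_of_le_one_right (h.nonneg q) (hS _)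
  have n2 : Summable fun q => ‖w' q • S (φ' q)‖ := by
    refine h'.tot.summable.of_nonneg_of_le (fun _ => norm_nonneg _) fun q => ?_
    rw [norm_smul, Real.norm_of_nonneg (h'.nonneg q)]
    exact mul_le_of_le_one_right (h'.nonneg q) (hS _)
  refine ⟨fun q => mul_nonneg (h.nonneg _) (h'.nonneg _), ?_, ?_⟩
  · have := aux_hasSum_mul h.tot h'.tot h.tot.summable.norm h'.tot.summable.norm
    rwa [one_mul] at this
  · have := aux_hasSum_mul h.rep h'.rep n1 n2
    refine this.aux_congr fun q => ?_
    rw [hadd, smul_mul_smul_comm]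

theorem AuxRep.equiv {Q Q' : Type*} {S : G → A} {w : Q → ℝ} {φ : Q → G} {T : A}
    (h : AuxRep S w φ T) (e : Q' ≃ Q) : AuxRep S (w ∘ e) (φ ∘ e) T :=
  ⟨fun q => h.nonneg _, e.hasSum_iff.2 h.tot, e.hasSum_iff.2 h.rep⟩

theorem aux_S_nsmul {S : G → A} (h0 : S 0 = 1) (hadd : ∀ a b, S (a + b) = S a * S b)
    (g : G) (k : ℕ) : S (k • g) = S g ^ k := by
  induction k with
  | zero => simpa using h0
  | succ k ih => rw [succ_nsmul, hadd, ih, pow_succ]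

theorem aux_S_sum {S : G → A} (h0 : S 0 = 1) (hadd : ∀ a b, S (a + b) = S a * S b)
    {ι : Type*} (s : Finset ι) (g : ι → G) : S (∑ i ∈ s, g i) = ∏ i ∈ s, S (g i) := by
  classical
  induction s using Finset.induction_on with
  | empty => simpa using h0
  | insert i s hi ih => rw [Finset.sum_insert hi, Finset.prod_insert hi, hadd, ih]

theorem aux_rep_pois_one {S : G → A} (h0 : S 0 = 1) (hadd : ∀ a b, S (a + b) = S a * S b)
    (g : G) (l : ℝ) (hl : 0 ≤ l) :
    AuxRep S (poisPMF l) (fun k : ℕ => k • g) (NormedSpace.exp (l • (S g - 1))) := by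
  refine ⟨fun q => by unfold poisPMF; positivity, ?_, ?_⟩
  · have g := (NormedSpace.exp_series_hasSum_exp' (𝕂 := ℝ) l).mul_left (Real.exp (-l))
    rw [← Real.exp_eq_exp_ℝ, ← Real.exp_add, neg_add_cancel, Real.exp_zero] at g
    refine g.aux_congr fun k => ?_
    unfold poisPMF
    rw [smul_eq_mul]; ring
  · have h := (NormedSpace.exp_series_hasSum_exp' (𝕂 := ℝ) (l • S g)).const_smul (Real.exp (-l))
    rw [← aux_exp_sub, ← smul_sub] at h
    refine h.aux_congr fun k => ?_
    unfold poisPMF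
    rw [aux_S_nsmul h0 hadd, smul_pow, smul_smul, smul_smul]
    congr 1
    ring

theorem aux_rep_pois {S : G → A} (hS : ∀ g, ‖S g‖ ≤ 1) (h0 : S 0 = 1)
    (hadd : ∀ a b, S (a + b) = S a * S b)
    (ι : Type*) [Fintype ι] : ∀ (g : ι → G) (l : ι → ℝ) (_ : ∀ i, 0 ≤ l i),
    AuxRep S (fun h : ι → ℕ => ∏ i, poisPMF (l i) (h i)) (fun h => ∑ i, h i • g i)
      (NormedSpace.exp (∑ i, l i • (S (g i) - 1))) := by
  refine Fintype.induction_empty_option (P := fun ι _ => ∀ (g : ι → G) (l : ι → ℝ) (_ : ∀ i, 0 ≤ l i),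
    AuxRep S (fun h : ι → ℕ => ∏ i, poisPMF (l i) (h i)) (fun h => ∑ i, h i • g i)
      (NormedSpace.exp (∑ i, l i • (S (g i) - 1)))) ?_ ?_ ?_ ι
  · intro α β _ e ih g l hl
    let _ : Fintype α := Fintype.ofEquiv _ e.symm
    have := (ih (g ∘ e) (l ∘ e) (fun i => hl _)).equiv (Equiv.arrowCongr e.symm (Equiv.refl ℕ))
    convert this using 1
    · funext h
      simp only [Function.comp]
      refine (Fintype.prod_equiv e _ _ ?_).symm
      simp
    · funext h
      simp only [Function.comp]
      refine (Fintype.sum_equiv e _ _ ?_).symm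
      simp
    · congr 1
      refine (Fintype.sum_equiv e _ _ ?_).symm
      simp
  · intro g l hl
    refine ⟨by simp, ?_, ?_⟩
    · simpa using hasSum_unique (fun _ : PEmpty → ℕ => (1 : ℝ))
    · simpa [h0] using hasSum_unique (fun _ : PEmpty → ℕ => (1 : A))
  · intro α _ ih g l hl
    have h1 := aux_rep_pois_one h0 hadd (g none) (l none) (hl none)
    have h2 := ih (fun i => g (some i)) (fun i => l (some i)) (fun i => hl _)
    have := (h1.mul hS hadd h2).equiv (Equiv.piOptionEquivProd (β := fun _ => ℕ))
    convert this using 1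
    · funext h
      simp [Fintype.prod_option]
    · funext h
      simp [Fintype.sum_option]
    · rw [Fintype.sum_option, aux_exp_add]

theorem aux_rep_multi {S : G → A} (h0 : S 0 = 1) (hadd : ∀ a b, S (a + b) = S a * S b)
    {Y : Type*} [Fintype Y] (g : Y → G) (W : Y → ℝ) (hW : ∀ y, 0 ≤ W y)
    (hW1 : ∑ y, W y = 1) (m : ℕ) :
    AuxRep S (multinomialPMF m W) (fun h => ∑ y, h y • g y) ((∑ y, W y • S (g y)) ^ m) := by
  classical
  refine ⟨fun h => ?_, ?_, ?_⟩
  · unfold multinomialPMF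
    split_ifs
    · exact mul_nonneg (Nat.cast_nonneg _) (Finset.prod_nonneg fun y _ => pow_nonneg (hW y) _)
    · exact le_rfl
  · have h := Finset.sum_pow_eq_sum_piAntidiag Finset.univ W m
    rw [hW1, one_pow] at h
    rw [h]
    have : ∑ k ∈ Finset.piAntidiag Finset.univ m,
        (Nat.multinomial Finset.univ k : ℝ) * ∏ i, W i ^ k i
        = ∑ k ∈ Finset.piAntidiag Finset.univ m, multinomialPMF m W k := by
      refine Finset.sum_congr rfl fun k hk => ?_
      rw [multinomialPMF, if_pos (by simpa using hk)]
    rw [this]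
    refine hasSum_sum_of_ne_finset_zero fun k hk => ?_
    rw [multinomialPMF, if_neg (by simpa using hk)]
  · rw [Finset.sum_pow_eq_sum_piAntidiag Finset.univ _ m]
    have : ∑ k ∈ Finset.piAntidiag Finset.univ m,
        (Nat.multinomial Finset.univ k : A) * ∏ i, (W i • S (g i)) ^ k i
        = ∑ k ∈ Finset.piAntidiag Finset.univ m, multinomialPMF m W k • S (∑ y, k y • g y) := by
      refine Finset.sum_congr rfl fun k hk => ?_
      rw [multinomialPMF, if_pos (by simpa using hk), aux_S_sum h0 hadd]
      simp only [aux_S_nsmul h0 hadd, smul_pow]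
      rw [Finset.prod_smul, mul_smul, Nat.cast_smul_eq_nsmul, nsmul_eq_mul]
    rw [this]
    refine hasSum_sum_of_ne_finset_zero fun k hk => ?_
    rw [multinomialPMF, if_neg (by simpa using hk), zero_smul]

/-- Passing from representations to measures. -/
theorem aux_measure {Q : Type*} [Countable G] [MeasurableSpace G] [MeasurableSingletonClass G]
    [DecidableEq G] {S : G → A} {w : Q → ℝ} {φ : Q → G} {T : A} (h : AuxRep S w φ T)
    (P : Measure G)
    (hP : ∀ g, P {g} = ENNReal.ofReal (∑' q, if φ q = g then w q else 0))
    (L : A →L[ℝ] ℝ) (B : Set G) (hL : ∀ g, L (S g) = B.indicator (fun _ => (1 : ℝ)) g - 1 / 2) :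
    (P B).toReal - 1 / 2 = L T := by
  have hPs : P = Measure.sum fun q => ENNReal.ofReal (w q) • Measure.dirac (φ q) := by
    refine Measure.ext_of_singleton fun g => ?_
    rw [hP, Measure.sum_apply _ (measurableSet_singleton g), ENNReal.ofReal_tsum_of_nonneg]
    · refine tsum_congr fun q => ?_
      rw [Measure.smul_apply, Measure.dirac_apply' _ (measurableSet_singleton g)]
      by_cases hq : φ q = g <;> simp [hq]
    · intro q
      split_ifs
      · exact h.nonneg q
      · exact le_rfl
    · refine h.tot.summable.of_nonneg_of_le (fun q => ?_) (fun q => ?_) <;> split_ifs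
      · exact h.nonneg q
      · exact le_rfl
      · exact le_rfl
      · exact h.nonneg q
  have hB : MeasurableSet B := B.to_countable.measurableSet
  have hs : Summable fun q => w q * B.indicator (fun _ => (1 : ℝ)) (φ q) := by
    refine h.tot.summable.of_nonneg_of_le (fun q => ?_) (fun q => ?_)
    · exact mul_nonneg (h.nonneg q) (Set.indicator_nonneg (fun _ _ => zero_le_one) _)
    · refine mul_le_of_le_one_right (h.nonneg q) ?_
      exact Set.indicator_le_self' (fun _ _ => zero_le_one) _
  have e1 : P B = ENNReal.ofReal (∑' q, w q * B.indicator (fun _ => (1 : ℝ)) (φ q)) := by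
    rw [hPs, Measure.sum_apply _ hB, ENNReal.ofReal_tsum_of_nonneg _ hs]
    · refine tsum_congr fun q => ?_
      rw [Measure.smul_apply, Measure.dirac_apply' _ hB]
      by_cases hq : φ q ∈ B <;> simp [hq]
    · intro q
      exact mul_nonneg (h.nonneg q) (Set.indicator_nonneg (fun _ _ => zero_le_one) _)
  rw [e1, ENNReal.toReal_ofReal (tsum_nonneg fun q =>
    mul_nonneg (h.nonneg q) (Set.indicator_nonneg (fun _ _ => zero_le_one) _))]
  have e2 := h.rep.mapL L
  have e3 := hs.hasSum.sub (h.tot.mul_right (1 / 2))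
  rw [one_mul] at e3
  refine e3.unique ?_
  refine e2.aux_congr fun q => ?_
  rw [map_smul, hL, smul_eq_mul]; ring

theorem aux_tv {Q Q' : Type*} [Countable G] [MeasurableSpace G] [MeasurableSingletonClass G]
    [DecidableEq G] {S : G → A}
    (hL : ∀ f : G → ℝ, (∀ g, |f g| ≤ 1 / 2) →
      ∃ L : A →L[ℝ] ℝ, (∀ g, L (S g) = f g) ∧ ∀ x, |L x| ≤ 1 / 2 * ‖x‖)
    {w : Q → ℝ} {φ : Q → G} {T : A} (h : AuxRep S w φ T)
    {w' : Q' → ℝ} {φ' : Q' → G} {T' : A} (h' : AuxRep S w' φ' T')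
    (P P' : Measure G)
    (hP : ∀ g, P {g} = ENNReal.ofReal (∑' q, if φ q = g then w q else 0))
    (hP' : ∀ g, P' {g} = ENNReal.ofReal (∑' q, if φ' q = g then w' q else 0))
    (b : ℝ) (hb : ‖T - T'‖ ≤ 2 * b) : tvDist P P' ≤ b := by
  have : Nonempty {s : Set G // MeasurableSet s} := ⟨⟨∅, MeasurableSet.empty⟩⟩
  refine ciSup_le fun B => ?_
  obtain ⟨L, hL1, hL2⟩ := hL (fun g => B.1.indicator (fun _ => (1 : ℝ)) g - 1 / 2) (fun g => by
    by_cases hg : g ∈ B.1 <;> simp [hg, abs_le] <;> norm_num)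
  have e1 := aux_measure h P hP L B.1 hL1
  have e2 := aux_measure h' P' hP' L B.1 hL1
  have e3 : (P B.1).toReal - (P' B.1).toReal = L (T - T') := by
    rw [map_sub]; linarith
  rw [e3]
  have := hL2 (T - T')
  linarith

end Representation

section Existence

theorem aux_exists_gen.{u} {G B : Type u} [AddCommGroup G] [NormedRing B] [NormedAlgebra ℝ B]
    [CompleteSpace B] (R : G → B) (hR0 : R 0 = 1) (hRadd : ∀ a b, R (a + b) = R a * R b)
    (hRn : ∀ g, ‖R g‖ ≤ 1)
    (hL : ∀ f : G → ℝ, (∀ g, |f g| ≤ 1 / 2) →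
        ∃ L : B →ₗ[ℝ] ℝ, (∀ g, L (R g) = f g) ∧ ∀ x, |L x| ≤ 1 / 2 * ‖x‖) :
    ∃ (A : Type u) (_ : NormedCommRing A) (_ : NormedAlgebra ℝ A) (_ : CompleteSpace A)
      (S : G → A), S 0 = 1 ∧ (∀ a b, S (a + b) = S a * S b) ∧ (∀ g, ‖S g‖ ≤ 1) ∧
      ∀ f : G → ℝ, (∀ g, |f g| ≤ 1 / 2) →
        ∃ L : A →L[ℝ] ℝ, (∀ g, L (S g) = f g) ∧ ∀ x, |L x| ≤ 1 / 2 * ‖x‖ := by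
  let C : Subalgebra ℝ B :=
    Subalgebra.centralizer ℝ (Subalgebra.centralizer ℝ (Set.range R) : Set _)
  have hmem : ∀ g, R g ∈ C := by
    intro g
    rw [Subalgebra.mem_centralizer_iff]
    intro x hx
    have hx' : x ∈ Subalgebra.centralizer ℝ (Set.range R) := hx
    rw [Subalgebra.mem_centralizer_iff] at hx'
    exact (hx' _ ⟨g, rfl⟩).symm
  have hcomm : ∀ x y : C, x * y = y * x := by
    intro x y
    have hx : (x : B) ∈ Subalgebra.centralizer ℝ (Set.range R) := by
      rw [Subalgebra.mem_centralizer_iff]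
      rintro _ ⟨g, rfl⟩
      have hx := x.2
      rw [Subalgebra.mem_centralizer_iff] at hx
      refine hx _ ?_
      change R g ∈ Subalgebra.centralizer ℝ (Set.range R)
      rw [Subalgebra.mem_centralizer_iff]
      rintro _ ⟨g', rfl⟩
      rw [← hRadd, ← hRadd, add_comm]
    have hy := y.2
    rw [Subalgebra.mem_centralizer_iff] at hy
    exact Subtype.ext (hy _ hx)
  have hclosed : IsClosed (C : Set B) := Set.isClosed_centralizer _
  let inst : NormedCommRing C := { (inferInstance : NormedRing C) with mul_comm := hcomm }
  let inst2 : NormedAlgebra ℝ C := { (inferInstance : NormedAlgebra ℝ C) with }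
  refine ⟨C, inst, inst2, hclosed.completeSpace_coe, fun g => ⟨R g, hmem g⟩, ?_, ?_, ?_, ?_⟩
  · exact Subtype.ext hR0
  · intro a b
    exact Subtype.ext (hRadd a b)
  · exact hRn
  · intro f hf
    obtain ⟨L, hL1, hL2⟩ := hL f hf
    let L0 : C →ₗ[ℝ] ℝ := 
      { toFun := fun x => L x
        map_add' := fun x y => L.map_add _ _
        map_smul' := fun r x => L.map_smul _ _ }
    exact ⟨L0.mkContinuous (1 / 2) (fun x => hL2 x), fun g => hL1 g, fun x => hL2 x⟩

open BoundedContinuousFunction in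
theorem aux_exists.{u} (G : Type u) [AddCommGroup G] :
    ∃ (A : Type u) (_ : NormedCommRing A) (_ : NormedAlgebra ℝ A) (_ : CompleteSpace A)
      (S : G → A), S 0 = 1 ∧ (∀ a b, S (a + b) = S a * S b) ∧ (∀ g, ‖S g‖ ≤ 1) ∧
      ∀ f : G → ℝ, (∀ g, |f g| ≤ 1 / 2) →
        ∃ L : A →L[ℝ] ℝ, (∀ g, L (S g) = f g) ∧ ∀ x, |L x| ≤ 1 / 2 * ‖x‖ := by
  let _ : TopologicalSpace G := ⊥
  have _ : DiscreteTopology G := ⟨rfl⟩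
  let R : G → ((G →ᵇ ℝ) →L[ℝ] (G →ᵇ ℝ)) := fun g =>
    BoundedContinuousFunction.compContinuousCLM ℝ ℝ ⟨fun x => x + g, continuous_of_discreteTopology⟩
  have hR : ∀ g f x, R g f x = f (x + g) := fun g f x => rfl
  refine aux_exists_gen R ?_ ?_ ?_ ?_
  · ext f x
    simp [hR]
  · intro a b
    ext f x
    simp [hR, add_assoc]
  · intro g
    refine ContinuousLinearMap.opNorm_le_bound _ zero_le_one fun f => ?_
    rw [one_mul]
    refine (BoundedContinuousFunction.norm_le (norm_nonneg _)).2 fun x => ?_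
    rw [hR]
    exact f.norm_coe_le_norm _
  · intro f hf
    let F : G →ᵇ ℝ := BoundedContinuousFunction.ofNormedAddCommGroupDiscrete f (1 / 2) hf
    have hF : ‖F‖ ≤ 1 / 2 := (BoundedContinuousFunction.norm_le (by norm_num)).2 hf
    have hb : ∀ x : (G →ᵇ ℝ) →L[ℝ] (G →ᵇ ℝ), |x F 0| ≤ 1 / 2 * ‖x‖ := by
      intro x
      calc _ ≤ ‖x F‖ := BoundedContinuousFunction.norm_coe_le_norm _ _
        _ ≤ ‖x‖ * ‖F‖ := ContinuousLinearMap.le_opNorm _ _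
        _ ≤ ‖x‖ * (1 / 2) := by gcongr
        _ = 1 / 2 * ‖x‖ := mul_comm _ _
    let L0 : ((G →ᵇ ℝ) →L[ℝ] (G →ᵇ ℝ)) →ₗ[ℝ] ℝ :=
      { toFun := fun x => x F 0
        map_add' := fun x y => rfl
        map_smul' := fun r x => rfl }
    refine ⟨L0, ?_, hb⟩
    intro g
    change f (0 + g) = f g
    rw [zero_add]

end Existence
section Final

/-- the vector `e_y - e_{y0}` -/
def auxDir {Y : Type*} [DecidableEq Y] (y0 y : Y) : Y → ℤ :=
  fun y' => (if y' = y then 1 else 0) - (if y' = y0 then 1 else 0)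

theorem aux_centered {A : Type*} [NormedCommRing A] [NormedAlgebra ℝ A] [CompleteSpace A]
    {Y : Type*} [Fintype Y] [DecidableEq Y] {S : (Y → ℤ) → A}
    (h0 : S 0 = 1) (hadd : ∀ a b, S (a + b) = S a * S b)
    (y0 : Y) (W : Y → ℝ) (hW : ∀ y, 0 ≤ W y) (hWs : ∑ y, W y = 1) (m : ℕ) :
    AuxRep S (multinomialPMF m W)
      (fun h y => (h y : ℤ) - (m : ℤ) * (if y = y0 then 1 else 0))
      ((1 + ∑ y ∈ Finset.univ.erase y0, W y • (S (auxDir y0 y) - 1)) ^ m) := by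
  have h := aux_rep_multi h0 hadd (auxDir y0) W hW hWs m
  have e : ∑ y, W y • S (auxDir y0 y)
      = 1 + ∑ y ∈ Finset.univ.erase y0, W y • (S (auxDir y0 y) - 1) := by
    rw [Finset.sum_erase]
    · rw [aux_sum_sub, hWs, one_smul]; ring
    · have : auxDir y0 y0 = 0 := by funext y; simp [auxDir]
      rw [this, h0, sub_self, smul_zero]
  rw [e] at h
  refine ⟨h.nonneg, h.tot, h.rep.aux_congr fun q => ?_⟩
  by_cases hq : ∑ y, q y = m
  · congr 2
    funext y
    simp only [Finset.sum_apply, Pi.smul_apply, auxDir, smul_sub, Finset.sum_sub_distrib]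
    rw [← Finset.sum_smul, hq]
    simp
  · simp [multinomialPMF, hq]

theorem aux_poisson {A : Type*} [NormedCommRing A] [NormedAlgebra ℝ A] [CompleteSpace A]
    {Y : Type*} [Fintype Y] [DecidableEq Y] {S : (Y → ℤ) → A} (hS : ∀ g, ‖S g‖ ≤ 1)
    (h0 : S 0 = 1) (hadd : ∀ a b, S (a + b) = S a * S b)
    (y0 : Y) (l : Y → ℝ) (hl : ∀ y, y ≠ y0 → 0 ≤ l y) :
    AuxRep S (fun q : Y → ℕ => ∏ y, poisPMF (if y = y0 then 0 else l y) (q y))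
      (fun q y' => ∑ y, (q y : ℤ) * ((if y' = y then 1 else 0) - (if y' = y0 then 1 else 0)))
      (NormedSpace.exp (∑ y ∈ Finset.univ.erase y0, l y • (S (auxDir y0 y) - 1))) := by
  have h := aux_rep_pois hS h0 hadd Y (auxDir y0) (fun y => if y = y0 then 0 else l y) (fun y => by
    split_ifs with hy
    · exact le_rfl
    · exact hl y hy)
  have e : ∑ y, (if y = y0 then 0 else l y) • (S (auxDir y0 y) - 1)
      = ∑ y ∈ Finset.univ.erase y0, l y • (S (auxDir y0 y) - 1) := by
    rw [← Finset.sum_erase (a := y0) Finset.univ (by simp)]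
    refine Finset.sum_congr rfl fun y hy => ?_
    rw [if_neg (Finset.ne_of_mem_erase hy)]
  rw [e] at h
  refine ⟨h.nonneg, h.tot, h.rep.aux_congr fun q => ?_⟩
  congr 2
  funext y'
  simp [Finset.sum_apply, auxDir]

theorem aux_main {Y : Type*} [Fintype Y] [DecidableEq Y] (y0 y1 : Y)
    (W0 W1 : Y → ℝ) (hW0 : ∀ y, 0 ≤ W0 y) (hW0s : ∑ y, W0 y = 1)
    (hW1 : ∀ y, 0 ≤ W1 y) (hW1s : ∑ y, W1 y = 1) (m0 m1 : ℕ)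
    (l0 l1 : Y → ℝ) (hl0 : ∀ y, y ≠ y0 → 0 ≤ l0 y) (hl1 : ∀ y, y ≠ y1 → 0 ≤ l1 y)
    (P Pinf : Measure (Y → ℤ))
    (hP : ∀ h : Y → ℤ, P {h} = ENNReal.ofReal (∑' q : (Y → ℕ) × (Y → ℕ),
      if (fun y => (q.1 y : ℤ) + (q.2 y : ℤ)
          - (m0 : ℤ) * (if y = y0 then 1 else 0)
          - (m1 : ℤ) * (if y = y1 then 1 else 0)) = h
      then multinomialPMF m0 W0 q.1 * multinomialPMF m1 W1 q.2 else 0))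
    (hPinf : ∀ h : Y → ℤ, Pinf {h} = ENNReal.ofReal (∑' q : (Y → ℕ) × (Y → ℕ),
      if (fun y' => (∑ y, (q.1 y : ℤ) * ((if y' = y then 1 else 0)
            - (if y' = y0 then 1 else 0)))
          + (∑ y, (q.2 y : ℤ) * ((if y' = y then 1 else 0)
            - (if y' = y1 then 1 else 0)))) = h
      then (∏ y, poisPMF (if y = y0 then 0 else l0 y) (q.1 y))
        * (∏ y, poisPMF (if y = y1 then 0 else l1 y) (q.2 y)) else 0)) :
    tvDist P Pinf
      ≤ (m0 : ℝ) * (1 - W0 y0) * (1 - Real.exp (-(1 - W0 y0)))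
        + (m1 : ℝ) * (1 - W1 y1) * (1 - Real.exp (-(1 - W1 y1)))
        + ∑ y ∈ Finset.univ.erase y0, |(m0 : ℝ) * W0 y - l0 y|
        + ∑ y ∈ Finset.univ.erase y1, |(m1 : ℝ) * W1 y - l1 y| := by
  obtain ⟨A, i1, i2, i3, S, h0, hadd, hS, hL⟩ := aux_exists (Y → ℤ)
  have h1 : ‖(1 : A)‖ ≤ 1 := by rw [← h0]; exact hS 0
  have a0 := aux_centered h0 hadd y0 W0 hW0 hW0s m0
  have a1 := aux_centered h0 hadd y1 W1 hW1 hW1s m1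
  have b0 := aux_poisson hS h0 hadd y0 l0 hl0
  have b1 := aux_poisson hS h0 hadd y1 l1 hl1
  have s0 : ∑ y ∈ Finset.univ.erase y0, W0 y = 1 - W0 y0 := by
    rw [← hW0s, ← Finset.sum_erase_add _ _ (Finset.mem_univ y0)]; ring
  have s1 : ∑ y ∈ Finset.univ.erase y1, W1 y = 1 - W1 y1 := by
    rw [← hW1s, ← Finset.sum_erase_add _ _ (Finset.mem_univ y1)]; ring
  have c0 := aux_block h1 (Finset.univ.erase y0) (fun y => S (auxDir y0 y)) (fun y => hS _) W0 l0
    (fun y _ => hW0 y) (by rw [s0]; linarith [hW0 y0])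
    (fun y hy => hl0 y (Finset.ne_of_mem_erase hy)) m0
  have c1 := aux_block h1 (Finset.univ.erase y1) (fun y => S (auxDir y1 y)) (fun y => hS _) W1 l1
    (fun y _ => hW1 y) (by rw [s1]; linarith [hW1 y1])
    (fun y hy => hl1 y (Finset.ne_of_mem_erase hy)) m1
  rw [s0] at c0
  rw [s1] at c1
  refine aux_tv hL (a0.mul hS hadd a1) (b0.mul hS hadd b1) P Pinf ?_ ?_ _
    ((aux_mul_diff (a1.norm_le hS) (b0.norm_le hS)).trans (by linarith))
  · intro g
    rw [hP g]
    congr 1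
    refine tsum_congr fun q => ?_
    have : (fun y => (q.1 y : ℤ) + (q.2 y : ℤ)
          - (m0 : ℤ) * (if y = y0 then 1 else 0)
          - (m1 : ℤ) * (if y = y1 then 1 else 0))
        = (fun y => (q.1 y : ℤ) - (m0 : ℤ) * (if y = y0 then 1 else 0))
          + (fun y => (q.2 y : ℤ) - (m1 : ℤ) * (if y = y1 then 1 else 0)) := by
      funext y
      simp only [Pi.add_apply]
      ring
    rw [this]
  · intro g
    exact hPinf g

end Final

/-- Critical multivariate Poisson/compound-Poisson limit for the released histogram:
explicit total-variation bounds between the law of the centered histogram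
`H = N⁽⁰⁾ + N⁽¹⁾ - (n-k)e_{y₀} - k e_{y₁}` (independent multinomials) and the law of the
compound-Poisson vector `H_∞ = ∑_{y≠y₀} U_y (e_y - e_{y₀}) + ∑_{y≠y₁} V_y (e_y - e_{y₁})`
with independent `U_y ~ Poi((1-π)α₀(y))`, `V_y ~ Poi(πα₁(y))`; and the analogous bound for
the neighboring composition `(n-k-1, k+1)`. -/
theorem stmt13 {Y : Type*} [Fintype Y] [DecidableEq Y]
    (y0 y1 : Y) (hy : y0 ≠ y1)
    (W0 W1 : Y → ℝ) (hW0 : ∀ y, 0 ≤ W0 y) (hW0s : ∑ y, W0 y = 1)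
    (hW1 : ∀ y, 0 ≤ W1 y) (hW1s : ∑ y, W1 y = 1)
    (n k : ℕ) (hn : 1 ≤ n) (hk : k ≤ n - 1)
    (p : ℝ) (hp0 : 0 ≤ p) (hp1 : p ≤ 1)
    (α0 α1 : Y → ℝ) (hα0 : ∀ y, y ≠ y0 → 0 ≤ α0 y) (hα1 : ∀ y, y ≠ y1 → 0 ≤ α1 y)
    (P P' Pinf : Measure (Y → ℤ))
    [IsProbabilityMeasure P] [IsProbabilityMeasure P'] [IsProbabilityMeasure Pinf]
    (hP : ∀ h : Y → ℤ, P {h} = ENNReal.ofReal (∑' q : (Y → ℕ) × (Y → ℕ),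
      if (fun y => (q.1 y : ℤ) + (q.2 y : ℤ)
          - ((n : ℤ) - k) * (if y = y0 then 1 else 0)
          - (k : ℤ) * (if y = y1 then 1 else 0)) = h
      then multinomialPMF (n - k) W0 q.1 * multinomialPMF k W1 q.2 else 0))
    (hP' : ∀ h : Y → ℤ, P' {h} = ENNReal.ofReal (∑' q : (Y → ℕ) × (Y → ℕ),
      if (fun y => (q.1 y : ℤ) + (q.2 y : ℤ)
          - ((n : ℤ) - k - 1) * (if y = y0 then 1 else 0)
          - ((k : ℤ) + 1) * (if y = y1 then 1 else 0)) = h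
      then multinomialPMF (n - k - 1) W0 q.1 * multinomialPMF (k + 1) W1 q.2 else 0))
    (hPinf : ∀ h : Y → ℤ, Pinf {h} = ENNReal.ofReal (∑' q : (Y → ℕ) × (Y → ℕ),
      if (fun y' => (∑ y, (q.1 y : ℤ) * ((if y' = y then 1 else 0)
            - (if y' = y0 then 1 else 0)))
          + (∑ y, (q.2 y : ℤ) * ((if y' = y then 1 else 0)
            - (if y' = y1 then 1 else 0)))) = h
      then (∏ y, poisPMF (if y = y0 then 0 else (1 - p) * α0 y) (q.1 y))
        * (∏ y, poisPMF (if y = y1 then 0 else p * α1 y) (q.2 y)) else 0)) :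
    tvDist P Pinf
      ≤ ((n : ℝ) - k) * (1 - W0 y0) * (1 - Real.exp (-(1 - W0 y0)))
        + (k : ℝ) * (1 - W1 y1) * (1 - Real.exp (-(1 - W1 y1)))
        + ∑ y ∈ Finset.univ.erase y0, |((n : ℝ) - k) * W0 y - (1 - p) * α0 y|
        + ∑ y ∈ Finset.univ.erase y1, |(k : ℝ) * W1 y - p * α1 y|
    ∧ tvDist P' Pinf
      ≤ ((n : ℝ) - k - 1) * (1 - W0 y0) * (1 - Real.exp (-(1 - W0 y0)))
        + ((k : ℝ) + 1) * (1 - W1 y1) * (1 - Real.exp (-(1 - W1 y1)))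
        + ∑ y ∈ Finset.univ.erase y0, |((n : ℝ) - k - 1) * W0 y - (1 - p) * α0 y|
        + ∑ y ∈ Finset.univ.erase y1, |((k : ℝ) + 1) * W1 y - p * α1 y| := by
  have hkn : k + 1 ≤ n := by omega
  have c1 : ((n - k : ℕ) : ℤ) = (n : ℤ) - k := by omega
  have c2 : ((n - k - 1 : ℕ) : ℤ) = (n : ℤ) - k - 1 := by omega
  have r1 : ((n - k : ℕ) : ℝ) = (n : ℝ) - k := by exact_mod_cast congrArg (Int.cast (R := ℝ)) c1
  have r2 : ((n - k - 1 : ℕ) : ℝ) = (n : ℝ) - k - 1 := by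
    exact_mod_cast congrArg (Int.cast (R := ℝ)) c2
  have hl0 : ∀ y, y ≠ y0 → 0 ≤ (1 - p) * α0 y := fun y h =>
    mul_nonneg (by linarith) (hα0 y h)
  have hl1 : ∀ y, y ≠ y1 → 0 ≤ p * α1 y := fun y h => mul_nonneg hp0 (hα1 y h)
  constructor
  · have := aux_main y0 y1 W0 W1 hW0 hW0s hW1 hW1s (n - k) k (fun y => (1 - p) * α0 y)
      (fun y => p * α1 y) hl0 hl1 P Pinf (by rw [c1]; exact hP) hPinf
    rw [r1] at this
    exact this
  · have := aux_main y0 y1 W0 W1 hW0 hW0s hW1 hW1s (n - k - 1) (k + 1) (fun y => (1 - p) * α0 y)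
      (fun y => p * α1 y) hl0 hl1 P' Pinf (by rw [c2]; push_cast; exact hP') hPinf
    rw [r2] at this
    push_cast at this
    exact this
end

section
/- Let ε₀(n) > 0 be a sequence with e^{ε₀(n)}/n → ∞, and set δ_n := (1 + e^{ε₀(n)})^{−1}. Let P_n = Binomial(n, δ_n) and let Q_n be the law of S + B, where S ~ Binomial(n−1, δ_n) and B ~ Bernoulli(1−δ_n) are independent. Then TV(P_n, Q_n) → 1 as n → ∞, and for every fixed ε ≥ 0, δ_{P_n‖Q_n}(ε) → 1; in particular the two-sided privacy curve max{δ_{Q_n‖P_n}(ε), δ_{P_n‖Q_n}(ε)} tends to 1 for every fixed ε ≥ 0. -/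
open MeasureTheory Filter

/-- One-sided privacy curve `δ_{Q‖P}(ε) = sup_A (Q(A) - e^ε P(A))`. -/
noncomputable def privDelta {Ω : Type*} [MeasurableSpace Ω] (P Q : Measure Ω) (ε : ℝ) : ℝ :=
  ⨆ A : {s : Set Ω // MeasurableSet s}, ((Q A.1).toReal - Real.exp ε * (P A.1).toReal)

/-- Binomial(m,p) probability mass function on ℕ. -/
noncomputable def binomPMF (m : ℕ) (p : ℝ) (k : ℕ) : ℝ :=
  (m.choose k : ℝ) * p ^ k * (1 - p) ^ (m - k)

/-- Bernoulli(p) probability mass function on ℕ (mass `p` at 1, `1-p` at 0). -/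
noncomputable def bernPMF (p : ℝ) (k : ℕ) : ℝ :=
  if k = 0 then 1 - p else if k = 1 then p else 0

/-- Convolution of two pmfs on ℕ: the pmf of the sum of independent variables. -/
noncomputable def convPMF (f g : ℕ → ℝ) (k : ℕ) : ℝ :=
  ∑ i ∈ Finset.range (k + 1), f i * g (k - i)

lemma privDelta_bdd (P Q : Measure ℕ) [IsProbabilityMeasure P] [IsProbabilityMeasure Q] (ε : ℝ)
    (A : Set ℕ) : (Q A).toReal - Real.exp ε * (P A).toReal ≤ 1 := by
  have h1 : (Q A).toReal ≤ 1 := measureReal_le_one (μ := Q) (s := A)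
  have h2 : 0 ≤ Real.exp ε * (P A).toReal := by positivity
  linarith

lemma privDelta_le (P Q : Measure ℕ) [IsProbabilityMeasure P] [IsProbabilityMeasure Q] (ε : ℝ) :
    privDelta P Q ε ≤ 1 := by
  have : Nonempty {s : Set ℕ // MeasurableSet s} := ⟨⟨∅, MeasurableSet.empty⟩⟩
  exact ciSup_le fun A => privDelta_bdd P Q ε A.1

lemma le_privDelta (P Q : Measure ℕ) [IsProbabilityMeasure P] [IsProbabilityMeasure Q] (ε : ℝ)
    (A : Set ℕ) : (Q A).toReal - Real.exp ε * (P A).toReal ≤ privDelta P Q ε := by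
  have hb : BddAbove (Set.range fun A : {s : Set ℕ // MeasurableSet s} =>
      ((Q A.1).toReal - Real.exp ε * (P A.1).toReal)) := by
    refine ⟨1, ?_⟩
    rintro _ ⟨B, rfl⟩
    exact privDelta_bdd P Q ε B.1
  exact le_ciSup hb ⟨A, MeasurableSet.of_discrete⟩

lemma tvDist_bdd (P Q : Measure ℕ) [IsProbabilityMeasure P] [IsProbabilityMeasure Q]
    (A : Set ℕ) : |(P A).toReal - (Q A).toReal| ≤ 1 := by
  have h1 : (Q A).toReal ≤ 1 := measureReal_le_one (μ := Q) (s := A)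
  have h2 : (P A).toReal ≤ 1 := measureReal_le_one (μ := P) (s := A)
  have h3 : 0 ≤ (P A).toReal := ENNReal.toReal_nonneg
  have h4 : 0 ≤ (Q A).toReal := ENNReal.toReal_nonneg
  rw [abs_le]
  constructor <;> linarith

lemma tvDist_le (P Q : Measure ℕ) [IsProbabilityMeasure P] [IsProbabilityMeasure Q] :
    tvDist P Q ≤ 1 := by
  have : Nonempty {s : Set ℕ // MeasurableSet s} := ⟨⟨∅, MeasurableSet.empty⟩⟩
  exact ciSup_le fun A => tvDist_bdd P Q A.1

lemma le_tvDist (P Q : Measure ℕ) [IsProbabilityMeasure P] [IsProbabilityMeasure Q]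
    (A : Set ℕ) : |(P A).toReal - (Q A).toReal| ≤ tvDist P Q := by
  have hb : BddAbove (Set.range fun A : {s : Set ℕ // MeasurableSet s} =>
      |(P A.1).toReal - (Q A.1).toReal|) := by
    refine ⟨1, ?_⟩
    rintro _ ⟨B, rfl⟩
    exact tvDist_bdd P Q B.1
  exact le_ciSup hb ⟨A, MeasurableSet.of_discrete⟩

/-- Super-critical RR yields asymptotic distinguishability for the canonical pair:
if `e^{ε₀(n)}/n → ∞` and `δ_n = (1+e^{ε₀(n)})⁻¹`, then `TV(P_n,Q_n) → 1`, the reverse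
curve `δ_{P_n‖Q_n}(ε) → 1`, and the two-sided privacy curve tends to `1` at every `ε ≥ 0`. -/
theorem stmt14 (ε0 : ℕ → ℝ) (hε0 : ∀ n, 0 < ε0 n)
    (hsup : Tendsto (fun n : ℕ => Real.exp (ε0 n) / n) atTop atTop)
    (Pn Qn : ℕ → Measure ℕ)
    [∀ n, IsProbabilityMeasure (Pn n)] [∀ n, IsProbabilityMeasure (Qn n)]
    (hPn : ∀ n k, Pn n {k} = ENNReal.ofReal (binomPMF n ((1 + Real.exp (ε0 n))⁻¹) k))
    (hQn : ∀ n k, Qn n {k} = ENNReal.ofReal (convPMF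
      (binomPMF (n - 1) ((1 + Real.exp (ε0 n))⁻¹))
      (bernPMF (1 - (1 + Real.exp (ε0 n))⁻¹)) k)) :
    Tendsto (fun n => tvDist (Pn n) (Qn n)) atTop (nhds 1)
    ∧ ∀ ε : ℝ, 0 ≤ ε →
      Tendsto (fun n => privDelta (Qn n) (Pn n) ε) atTop (nhds 1)
      ∧ Tendsto (fun n => max (privDelta (Pn n) (Qn n) ε) (privDelta (Qn n) (Pn n) ε))
          atTop (nhds 1) := by
  set u : ℕ → ℝ := fun n => (Real.exp (ε0 n) / n)⁻¹ with hu
  have hu0 : Tendsto u atTop (nhds 0) := tendsto_inv_atTop_zero.comp hsup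
  have hδ : ∀ n : ℕ, 0 < (1 + Real.exp (ε0 n))⁻¹ ∧ (1 + Real.exp (ε0 n))⁻¹ ≤ 1 ∧
      (n : ℝ) * (1 + Real.exp (ε0 n))⁻¹ ≤ u n := by
    intro n
    have he := Real.exp_pos (ε0 n)
    refine ⟨by positivity, inv_le_one_of_one_le₀ (by linarith), ?_⟩
    rw [hu]
    simp only [inv_div]
    rw [div_eq_mul_inv]
    gcongr
    linarith
  have hP : ∀ n, 1 - u n ≤ (Pn n {0}).toReal := by
    intro n
    obtain ⟨h1, h2, h3⟩ := hδ n
    rw [hPn]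
    generalize (1 + Real.exp (ε0 n))⁻¹ = d at *
    have hb : binomPMF n d 0 = (1 - d) ^ n := by simp [binomPMF]
    rw [hb, ENNReal.toReal_ofReal (pow_nonneg (by linarith) _)]
    have := one_add_mul_le_pow (a := -d) (by linarith) n
    rw [← sub_eq_add_neg] at this
    linarith
  have hQ : ∀ n, 1 ≤ n → (Qn n {0}).toReal ≤ u n := by
    intro n hn
    obtain ⟨h1, h2, h3⟩ := hδ n
    rw [hQn]
    generalize (1 + Real.exp (ε0 n))⁻¹ = d at *
    have hb : convPMF (binomPMF (n - 1) d) (bernPMF (1 - d)) 0 = (1 - d) ^ (n - 1) * d := by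
      simp [convPMF, binomPMF, bernPMF]
    have hp : 0 ≤ (1 - d) ^ (n - 1) := pow_nonneg (by linarith) _
    have hp1 : (1 - d) ^ (n - 1) ≤ 1 := pow_le_one₀ (by linarith) (by linarith)
    rw [hb, ENNReal.toReal_ofReal (mul_nonneg hp h1.le)]
    have hn' : (1 : ℝ) ≤ n := by exact_mod_cast hn
    nlinarith
  have key : ∀ ε : ℝ, Tendsto (fun n => 1 - u n - Real.exp ε * u n) atTop (nhds 1) := by
    intro ε
    have := (hu0.const_sub 1).sub (hu0.const_mul (Real.exp ε))
    simpa using this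
  have hD : ∀ ε : ℝ, ∀ᶠ n in atTop,
      1 - u n - Real.exp ε * u n ≤ privDelta (Qn n) (Pn n) ε := by
    intro ε
    filter_upwards [eventually_ge_atTop 1] with n hn
    have h1 := le_privDelta (Qn n) (Pn n) ε {0}
    have h2 := mul_le_mul_of_nonneg_left (hQ n hn) (Real.exp_pos ε).le
    linarith [hP n]
  refine ⟨?_, fun ε _ => ⟨?_, ?_⟩⟩
  · refine tendsto_of_tendsto_of_tendsto_of_le_of_le' (key 0) tendsto_const_nhds ?_
      (Eventually.of_forall fun n => tvDist_le (Pn n) (Qn n))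
    filter_upwards [eventually_ge_atTop 1] with n hn
    have h1 := le_tvDist (Pn n) (Qn n) {0}
    have h2 := le_abs_self ((Pn n {0}).toReal - (Qn n {0}).toReal)
    rw [Real.exp_zero]
    linarith [hP n, hQ n hn]
  · exact tendsto_of_tendsto_of_tendsto_of_le_of_le' (key ε) tendsto_const_nhds (hD ε)
      (Eventually.of_forall fun n => privDelta_le (Qn n) (Pn n) ε)
  · refine tendsto_of_tendsto_of_tendsto_of_le_of_le' (key ε) tendsto_const_nhds ?_
      (Eventually.of_forall fun n =>
        max_le (privDelta_le (Pn n) (Qn n) ε) (privDelta_le (Qn n) (Pn n) ε))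
    filter_upwards [hD ε] with n hn
    exact hn.trans (le_max_right _ _)
end

section
/- Let ε₀(n) > 0 be a sequence with e^{ε₀(n)}/n → ∞, set δ_n := (1 + e^{ε₀(n)})^{−1}, and let k = k(n) ∈ {0, …, n−1} be an arbitrary composition sequence. Let P_n be the law of k + A − B with A ~ Binomial(n−k, δ_n) and B ~ Binomial(k, δ_n) independent, and let Q_n be the law of k + 1 + A′ − B′ with A′ ~ Binomial(n−k−1, δ_n) and B′ ~ Binomial(k+1, δ_n) independent. Then TV(P_n, Q_n) → 1 as n → ∞; equivalently, for every fixed ε ≥ 0, the two-sided privacy curve max{δ_{Q_n‖P_n}(ε), δ_{P_n‖Q_n}(ε)} tends to 1. -/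
open MeasureTheory Filter

/-- pmf on ℤ of the difference `X - Y` of independent ℕ-valued variables with pmfs `f`, `g`. -/
noncomputable def diffPMF (f g : ℕ → ℝ) (d : ℤ) : ℝ :=
  ∑' q : ℕ × ℕ, if (q.1 : ℤ) - (q.2 : ℤ) = d then f q.1 * g q.2 else 0

lemma binomPMF_nonneg' (m : ℕ) (p : ℝ) (h0 : 0 ≤ p) (h1 : p ≤ 1) (j : ℕ) :
    0 ≤ binomPMF m p j := by
  have : 0 ≤ 1 - p := by linarith
  unfold binomPMF; positivity

lemma diffPMF_zero_ge (a b : ℕ) (p : ℝ) (h0 : 0 ≤ p) (h1 : p ≤ 1) :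
    1 - ((a + b : ℕ) : ℝ) * p ≤ diffPMF (binomPMF a p) (binomPMF b p) 0 := by
  have hs : Summable (fun q : ℕ × ℕ => if (q.1 : ℤ) - (q.2 : ℤ) = 0 then
      binomPMF a p q.1 * binomPMF b p q.2 else 0) := by
    apply summable_of_ne_finset_zero (s := Finset.range (a+1) ×ˢ Finset.range (b+1))
    intro q hq
    have hq' : a < q.1 ∨ b < q.2 := by
      by_contra hcon
      apply hq
      simp only [Finset.mem_product, Finset.mem_range]
      omega
    split_ifs
    · rcases hq' with h | h
      · simp [binomPMF, Nat.choose_eq_zero_of_lt h]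
      · simp [binomPMF, Nat.choose_eq_zero_of_lt h]
    · rfl
  have hle := hs.le_tsum (0, 0) (by
    intro q _
    split_ifs
    · exact mul_nonneg (binomPMF_nonneg' _ _ h0 h1 _) (binomPMF_nonneg' _ _ h0 h1 _)
    · exact le_rfl)
  have hb := one_add_mul_le_pow (a := -p) (by linarith) (a + b)
  unfold diffPMF
  refine le_trans ?_ hle
  simp only [binomPMF, Nat.cast_zero, sub_self, if_true, Nat.choose_zero_right, pow_zero,
    Nat.sub_zero, Nat.cast_one, one_mul, ← pow_add]
  have e : (1 + -p) = 1 - p := by ring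
  rw [e] at hb
  linarith

lemma compl_bound (μ : Measure ℤ) [IsProbabilityMeasure μ] (x y : ℤ) (h : x ≠ y) :
    (μ {x}).toReal ≤ 1 - (μ {y}).toReal := by
  have h1 : μ.real {x} + μ.real {y} = μ.real ({x} ∪ {y}) :=
    (measureReal_union (by simpa using h) (measurableSet_singleton y)).symm
  have h2 : μ.real ({x} ∪ {y}) ≤ 1 := measureReal_le_one
  simp only [Measure.real] at h1 h2
  linarith

lemma toReal_mem (μ : Measure ℤ) [IsProbabilityMeasure μ] (s : Set ℤ) :
    0 ≤ (μ s).toReal ∧ (μ s).toReal ≤ 1 :=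
  ⟨ENNReal.toReal_nonneg, measureReal_le_one⟩

lemma tv_bounds (P Q : Measure ℤ) [IsProbabilityMeasure P] [IsProbabilityMeasure Q]
    (x y : ℤ) (h : x ≠ y) (a : ℝ) (hP : a ≤ (P {x}).toReal) (hQ : a ≤ (Q {y}).toReal) :
    2 * a - 1 ≤ tvDist P Q ∧ tvDist P Q ≤ 1 := by
  have hle : ∀ A : {s : Set ℤ // MeasurableSet s}, |(P A.1).toReal - (Q A.1).toReal| ≤ 1 := by
    intro A
    have h1 := toReal_mem P A.1
    have h2 := toReal_mem Q A.1
    rw [abs_le]; constructor <;> linarith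
  constructor
  · refine le_trans ?_ (le_ciSup (f := fun A : {s : Set ℤ // MeasurableSet s} =>
      |(P A.1).toReal - (Q A.1).toReal|) ⟨1, ?_⟩ ⟨{x}, measurableSet_singleton x⟩)
    · refine le_trans ?_ (le_abs_self _)
      have := compl_bound Q x y h
      simp only
      linarith
    · rintro _ ⟨A, rfl⟩; exact hle A
  · haveI : Nonempty {s : Set ℤ // MeasurableSet s} := ⟨⟨∅, MeasurableSet.empty⟩⟩
    exact ciSup_le hle

lemma priv_bounds (P Q : Measure ℤ) [IsProbabilityMeasure P] [IsProbabilityMeasure Q] (ε : ℝ)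
    (x y : ℤ) (h : x ≠ y) (a : ℝ) (hP : a ≤ (P {x}).toReal) (hQ : a ≤ (Q {y}).toReal) :
    a - Real.exp ε * (1 - a) ≤ privDelta P Q ε ∧ privDelta P Q ε ≤ 1 := by
  have he := Real.exp_pos ε
  have hle : ∀ A : {s : Set ℤ // MeasurableSet s},
      (Q A.1).toReal - Real.exp ε * (P A.1).toReal ≤ 1 := by
    intro A
    have h1 := mul_nonneg he.le (toReal_mem P A.1).1
    have h2 := toReal_mem Q A.1
    linarith
  constructor
  · refine le_trans ?_ (le_ciSup (f := fun A : {s : Set ℤ // MeasurableSet s} =>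
      (Q A.1).toReal - Real.exp ε * (P A.1).toReal) ⟨1, ?_⟩ ⟨{y}, measurableSet_singleton y⟩)
    · have h3 := compl_bound P y x h.symm
      have h4 : Real.exp ε * (P {y}).toReal ≤ Real.exp ε * (1 - a) :=
        mul_le_mul_of_nonneg_left (by linarith) he.le
      simp only
      linarith
    · rintro _ ⟨A, rfl⟩; exact hle A
  · haveI : Nonempty {s : Set ℤ // MeasurableSet s} := ⟨⟨∅, MeasurableSet.empty⟩⟩
    exact ciSup_le hle

/-- Super-critical RR for arbitrary compositions: if `e^{ε₀(n)}/n → ∞`,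
`δ_n = (1+e^{ε₀(n)})⁻¹`, `P_n = law(k + Bin(n-k,δ_n) - Bin(k,δ_n))` and
`Q_n = law(k+1 + Bin(n-k-1,δ_n) - Bin(k+1,δ_n))`, then `TV(P_n,Q_n) → 1`; equivalently,
the two-sided privacy curve tends to `1` at every fixed `ε ≥ 0`. -/
theorem stmt15 (ε0 : ℕ → ℝ) (hε0 : ∀ n, 0 < ε0 n)
    (hsup : Tendsto (fun n : ℕ => Real.exp (ε0 n) / n) atTop atTop)
    (k : ℕ → ℕ) (hk : ∀ n : ℕ, 1 ≤ n → k n ≤ n - 1)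
    (Pn Qn : ℕ → Measure ℤ)
    [∀ n, IsProbabilityMeasure (Pn n)] [∀ n, IsProbabilityMeasure (Qn n)]
    (hPn : ∀ n d, Pn n {d} = ENNReal.ofReal (diffPMF
      (binomPMF (n - k n) ((1 + Real.exp (ε0 n))⁻¹))
      (binomPMF (k n) ((1 + Real.exp (ε0 n))⁻¹)) (d - k n)))
    (hQn : ∀ n d, Qn n {d} = ENNReal.ofReal (diffPMF
      (binomPMF (n - k n - 1) ((1 + Real.exp (ε0 n))⁻¹))
      (binomPMF (k n + 1) ((1 + Real.exp (ε0 n))⁻¹)) (d - k n - 1))) :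
    Tendsto (fun n => tvDist (Pn n) (Qn n)) atTop (nhds 1)
    ∧ ∀ ε : ℝ, 0 ≤ ε →
      Tendsto (fun n => max (privDelta (Pn n) (Qn n) ε) (privDelta (Qn n) (Pn n) ε))
        atTop (nhds 1) := by
  set a : ℕ → ℝ := fun n => 1 - (n : ℝ) * (1 + Real.exp (ε0 n))⁻¹ with ha
  have hlim : Tendsto a atTop (nhds 1) := by
    have h0 : Tendsto (fun n : ℕ => (n : ℝ) * (1 + Real.exp (ε0 n))⁻¹) atTop (nhds 0) := by
      refine squeeze_zero (fun n => by positivity) (fun n => ?_) hsup.inv_tendsto_atTop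
      simp only [Pi.inv_apply, inv_div, div_eq_mul_inv (n : ℝ)]
      gcongr
      linarith
    simpa [ha] using h0.const_sub 1
  have p0 : ∀ n, 0 ≤ (1 + Real.exp (ε0 n))⁻¹ := fun n => by positivity
  have p1 : ∀ n, (1 + Real.exp (ε0 n))⁻¹ ≤ 1 := fun n =>
    inv_le_one_of_one_le₀ (by linarith [Real.exp_pos (ε0 n)])
  have hP : ∀ n, 1 ≤ n → a n ≤ (Pn n {(k n : ℤ)}).toReal := by
    intro n hn
    have hkn := hk n hn
    have h := diffPMF_zero_ge (n - k n) (k n) _ (p0 n) (p1 n)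
    rw [show n - k n + k n = n by omega] at h
    rw [hPn, sub_self, ENNReal.toReal_ofReal']
    exact h.trans (le_max_left _ _)
  have hQ : ∀ n, 1 ≤ n → a n ≤ (Qn n {(k n : ℤ) + 1}).toReal := by
    intro n hn
    have hkn := hk n hn
    have h := diffPMF_zero_ge (n - k n - 1) (k n + 1) _ (p0 n) (p1 n)
    rw [show n - k n - 1 + (k n + 1) = n by omega] at h
    rw [hQn, show (k n : ℤ) + 1 - k n - 1 = 0 by ring, ENNReal.toReal_ofReal']
    exact h.trans (le_max_left _ _)
  constructor
  · have hl : Tendsto (fun n => 2 * a n - 1) atTop (nhds 1) := by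
      have := (hlim.const_mul 2).sub_const 1
      norm_num at this
      exact this
    refine tendsto_of_tendsto_of_tendsto_of_le_of_le' hl tendsto_const_nhds ?_ ?_ <;>
    filter_upwards [eventually_ge_atTop 1] with n hn
    · exact (tv_bounds _ _ _ _ (by omega) _ (hP n hn) (hQ n hn)).1
    · exact (tv_bounds _ _ _ _ (by omega) _ (hP n hn) (hQ n hn)).2
  · intro ε _
    have hl : Tendsto (fun n => a n - Real.exp ε * (1 - a n)) atTop (nhds 1) := by
      have := hlim.sub ((hlim.const_sub 1).const_mul (Real.exp ε))
      simpa using this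
    refine tendsto_of_tendsto_of_tendsto_of_le_of_le' hl tendsto_const_nhds ?_ ?_ <;>
    filter_upwards [eventually_ge_atTop 1] with n hn
    · exact (priv_bounds _ _ ε _ _ (by omega) _ (hP n hn) (hQ n hn)).1.trans (le_max_left _ _)
    · exact max_le (priv_bounds _ _ ε _ _ (by omega) _ (hP n hn) (hQ n hn)).2
        (priv_bounds _ _ ε _ _ (by omega) _ (hQ n hn) (hP n hn)).2
end

section
/- Let m ≥ 1 and p ∈ (0,1), let S ~ Binomial(m, p), and let N ~ Poisson(mp). Then TV(law(S), law(N)) ≤ mp(1 − e^{−p}) ≤ mp². -/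
open MeasureTheory Filter

lemma conv_real_nat (μ ν : Measure ℕ) [IsProbabilityMeasure μ] [IsProbabilityMeasure ν]
    (A : Set ℕ) :
    (μ.conv ν).real A = ∫ x, ν.real ((fun y => x + y) ⁻¹' A) ∂μ := by
  have h : (μ.conv ν) A = ∫⁻ x, ν ((fun y => x + y) ⁻¹' A) ∂μ := by
    unfold Measure.conv
    rw [Measure.map_apply (by fun_prop) .of_discrete, Measure.prod_apply .of_discrete]
    rfl
  rw [measureReal_def, h, ← integral_toReal (Measurable.of_discrete).aemeasurable
    (Eventually.of_forall fun x => measure_lt_top _ _)]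
  rfl

lemma conv_left_bound (μ ν ρ : Measure ℕ) [IsProbabilityMeasure μ] [IsProbabilityMeasure ν]
    [IsProbabilityMeasure ρ] (b : ℝ) (h : ∀ A : Set ℕ, |μ.real A - ν.real A| ≤ b) (A : Set ℕ) :
    |(ρ.conv μ).real A - (ρ.conv ν).real A| ≤ b := by
  have hi : ∀ κ : Measure ℕ, IsProbabilityMeasure κ →
      Integrable (fun x => κ.real ((fun y => x + y) ⁻¹' A)) ρ := by
    intro κ _
    refine Integrable.of_bound (C := 1) (Measurable.of_discrete).aestronglyMeasurable
      (Eventually.of_forall fun x => ?_)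
    rw [Real.norm_of_nonneg measureReal_nonneg]
    exact measureReal_le_one
  rw [conv_real_nat, conv_real_nat, ← integral_sub (hi μ inferInstance) (hi ν inferInstance)]
  have := norm_integral_le_of_norm_le_const (μ := ρ) (C := b)
    (f := fun x => μ.real ((fun y => x + y) ⁻¹' A) - ν.real ((fun y => x + y) ⁻¹' A))
    (Eventually.of_forall fun x => h _)
  simpa using this

lemma conv_bound (μ ν β π : Measure ℕ) [IsProbabilityMeasure μ] [IsProbabilityMeasure ν]
    [IsProbabilityMeasure β] [IsProbabilityMeasure π] (a b : ℝ)
    (h : ∀ A : Set ℕ, |μ.real A - ν.real A| ≤ a)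
    (hb : ∀ A : Set ℕ, |β.real A - π.real A| ≤ b) (A : Set ℕ) :
    |(μ.conv β).real A - (ν.conv π).real A| ≤ a + b := by
  have h1 := conv_left_bound μ ν β a h A
  have h2 := conv_left_bound β π ν b hb A
  rw [Measure.conv_comm β μ, Measure.conv_comm β ν] at h1
  exact (abs_sub_le _ ((ν.conv β).real A) _).trans (add_le_add h1 h2)

/-- Bernoulli measure on the naturals. -/
noncomputable def bernM (p : ℝ) : Measure ℕ :=
  ENNReal.ofReal (1 - p) • Measure.dirac 0 + ENNReal.ofReal p • Measure.dirac 1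

lemma bernM_prob (p : ℝ) (hp0 : 0 < p) (hp1 : p < 1) : IsProbabilityMeasure (bernM p) := by
  constructor
  simp only [bernM, Measure.add_apply, Measure.smul_apply, measure_univ, smul_eq_mul, mul_one]
  rw [← ENNReal.ofReal_add (by linarith) hp0.le]
  simp

lemma bernM_real (p : ℝ) (hp0 : 0 < p) (hp1 : p < 1) (A : Set ℕ) :
    (bernM p).real A = (1 - p) * A.indicator 1 0 + p * A.indicator 1 1 := by
  have h1 : 0 ≤ 1 - p := by linarith
  by_cases h0 : 0 ∈ A <;> by_cases h1 : 1 ∈ A <;>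
    simp [measureReal_def, bernM, h0, h1, hp0.le, hp1.le, ENNReal.toReal_add]

lemma bern_pois_upper (p : ℝ) (hp0 : 0 < p) (hp1 : p < 1) (π : Measure ℕ) [IsProbabilityMeasure π]
    (hπ : ∀ k, π.real {k} = poisPMF p k) (A : Set ℕ) :
    (bernM p).real A - π.real A ≤ p * (1 - Real.exp (-p)) := by
  have e0 : π.real {0} = Real.exp (-p) := by simp [hπ, poisPMF]
  have e1 : π.real {1} = Real.exp (-p) * p := by simp [hπ, poisPMF]
  have he := Real.add_one_le_exp (-p)
  have he1 : Real.exp (-p) ≤ 1 := Real.exp_le_one_iff.2 (by linarith)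
  rw [bernM_real p hp0 hp1]
  have hm : ∀ B : Set ℕ, B ⊆ A → π.real B ≤ π.real A := fun B hB => measureReal_mono hB
  have hnn : 0 ≤ π.real A := measureReal_nonneg
  by_cases h0 : 0 ∈ A <;> by_cases h1 : 1 ∈ A
  · have h2 := hm ({0} ∪ {1}) (by grind)
    rw [measureReal_union (by simp) (by simp), e0, e1] at h2
    simp [h0, h1]
    nlinarith
  · have h2 := hm {0} (by grind)
    simp [h0, h1]
    nlinarith
  · have h2 := hm {1} (by grind)
    simp [h0, h1]
    nlinarith
  · simp [h0, h1]
    nlinarith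

lemma bern_pois (p : ℝ) (hp0 : 0 < p) (hp1 : p < 1) (π : Measure ℕ) [IsProbabilityMeasure π]
    (hπ : ∀ k, π.real {k} = poisPMF p k) (A : Set ℕ) :
    |(bernM p).real A - π.real A| ≤ p * (1 - Real.exp (-p)) := by
  have := bernM_prob p hp0 hp1
  have h1 := bern_pois_upper p hp0 hp1 π hπ A
  have h2 := bern_pois_upper p hp0 hp1 π hπ Aᶜ
  rw [probReal_compl_eq_one_sub .of_discrete, probReal_compl_eq_one_sub .of_discrete] at h2
  rw [abs_le]
  constructor <;> linarith

/-- Binomial measure as an iterated convolution. -/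
noncomputable def binM (p : ℝ) : ℕ → Measure ℕ
  | 0 => Measure.dirac 0
  | m + 1 => (binM p m).conv (bernM p)

lemma binM_prob (p : ℝ) (hp0 : 0 < p) (hp1 : p < 1) (m : ℕ) : IsProbabilityMeasure (binM p m) := by
  have := bernM_prob p hp0 hp1
  induction m with
  | zero => simp only [binM]; infer_instance
  | succ m ih => simp only [binM]; infer_instance

lemma binM_singleton (p : ℝ) (hp0 : 0 < p) (hp1 : p < 1) (m k : ℕ) :
    (binM p m).real {k} = binomPMF m p k := by
  have := bernM_prob p hp0 hp1
  have := binM_prob p hp0 hp1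
  have hbern : ∀ (μ : Measure ℕ) [IsProbabilityMeasure μ] (A : Set ℕ),
      ((bernM p).conv μ).real A =
        (1 - p) * μ.real A + p * μ.real ((fun y => 1 + y) ⁻¹' A) := by
    intro μ _ A
    rw [conv_real_nat, bernM, integral_add_measure, integral_smul_measure, integral_smul_measure]
    · simp [hp0.le, hp1.le]
    · exact (integrable_dirac (by simp)).smul_measure (by simp)
    · exact (integrable_dirac (by simp)).smul_measure (by simp)
  induction m generalizing k with
  | zero =>
    rcases k with _ | k <;> simp [binM, binomPMF, measureReal_def]
  | succ m ih =>
    rw [binM, Measure.conv_comm, hbern, ih]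
    rcases k with _ | k
    · have : (fun y => 1 + y) ⁻¹' ({0} : Set ℕ) = ∅ := by ext; simp
      rw [this]
      simp [binomPMF, pow_succ]
      ring
    · have : (fun y => 1 + y) ⁻¹' ({k + 1} : Set ℕ) = {k} := by
        ext; simp [add_comm]
      rw [this, ih]
      simp only [binomPMF, Nat.choose_succ_succ, Nat.add_sub_add_right]
      push_cast
      rcases lt_or_ge k m with h | h
      · obtain ⟨d, rfl⟩ := Nat.exists_eq_add_of_lt h
        have e1 : k + d + 1 - (k + 1) = d := by omega
        have e2 : k + d + 1 - k = d + 1 := by omega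
        rw [e1, e2]
        ring
      · rw [Nat.choose_eq_zero_of_lt (show m < k + 1 by omega)]
        simp
        ring

lemma main_bound (p : ℝ) (hp0 : 0 < p) (hp1 : p < 1) (m : ℕ) (A : Set ℕ) :
    |(binM p m).real A - (ProbabilityTheory.poissonMeasure (m * p.toNNReal)).real A|
      ≤ m * (p * (1 - Real.exp (-p))) := by
  have := bernM_prob p hp0 hp1
  have := binM_prob p hp0 hp1
  induction m generalizing A with
  | zero =>
    have : ProbabilityTheory.poissonMeasure 0 = Measure.dirac 0 := by
      refine Measure.ext_of_singleton fun k => ?_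
      rw [ProbabilityTheory.poissonMeasure_singleton]
      rcases k with _ | k <;> simp
    simp [binM, this]
  | succ m ih =>
    push_cast
    rw [add_mul, add_mul, one_mul, one_mul, ← ProbabilityTheory.poissonMeasure_conv_poissonMeasure, binM]
    refine conv_bound _ _ _ _ _ _ ih (bern_pois p hp0 hp1 _ fun k => ?_) A
    rw [ProbabilityTheory.poissonMeasure_real_singleton, poisPMF, Real.coe_toNNReal _ hp0.le]

/-- Binomial-to-Poisson total variation bound:
`TV(Bin(m,p), Poi(mp)) ≤ mp(1-e^{-p}) ≤ mp²`. -/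
theorem stmt17 (m : ℕ) (hm : 1 ≤ m) (p : ℝ) (hp0 : 0 < p) (hp1 : p < 1)
    (μ ν : Measure ℕ) [IsProbabilityMeasure μ] [IsProbabilityMeasure ν]
    (hμ : ∀ k, μ {k} = ENNReal.ofReal (binomPMF m p k))
    (hν : ∀ k, ν {k} = ENNReal.ofReal (poisPMF ((m : ℝ) * p) k)) :
    tvDist μ ν ≤ (m : ℝ) * p * (1 - Real.exp (-p))
    ∧ (m : ℝ) * p * (1 - Real.exp (-p)) ≤ (m : ℝ) * p ^ 2 := by
  have he := Real.add_one_le_exp (-p)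
  have hmp : 0 ≤ (m : ℝ) * p := by positivity
  refine ⟨?_, by nlinarith⟩
  have := binM_prob p hp0 hp1
  have e1 : μ = binM p m := by
    refine Measure.ext_of_singleton fun k => ?_
    rw [hμ, ← binM_singleton p hp0 hp1, ofReal_measureReal]
  have e2 : ν = ProbabilityTheory.poissonMeasure (m * p.toNNReal) := by
    refine Measure.ext_of_singleton fun k => ?_
    rw [hν, ProbabilityTheory.poissonMeasure_singleton, poisPMF]
    simp [hp0.le]
  have : Nonempty {s : Set ℕ // MeasurableSet s} := ⟨⟨∅, .empty⟩⟩
  refine ciSup_le fun A => ?_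
  rw [mul_assoc, e1, e2]
  exact main_bound p hp0 hp1 m A.1
end

section
/- Let λ, λ' ≥ 0. Then the total variation distance between Poisson distributions satisfies TV(Poisson(λ), Poisson(λ')) ≤ 1 − e^{−|λ − λ'|} ≤ |λ − λ'|. -/
open MeasureTheory Filter

theorem pois_aux (l l' : ℝ) (hl : 0 ≤ l) (hll : l ≤ l')
    (μ ν : Measure ℕ) [IsProbabilityMeasure μ] [IsProbabilityMeasure ν]
    (hμ : ∀ k, μ {k} = ENNReal.ofReal (poisPMF l k))
    (hν : ∀ k, ν {k} = ENNReal.ofReal (poisPMF l' k)) (A : Set ℕ) :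
    |(μ A).toReal - (ν A).toReal| ≤ 1 - Real.exp (-(l' - l)) := by
  set c := Real.exp (-(l' - l)) with hc
  have hc0 : 0 ≤ c := (Real.exp_pos _).le
  have hc1 : c ≤ 1 := Real.exp_le_one_iff.mpr (by linarith)
  have hpt : ∀ k, ENNReal.ofReal c * μ {k} ≤ ν {k} := by
    intro k
    rw [hμ, hν, ← ENNReal.ofReal_mul hc0]
    apply ENNReal.ofReal_le_ofReal
    unfold poisPMF
    have he : c * (Real.exp (-l) * l ^ k / (k.factorial : ℝ))
        = Real.exp (-l') * l ^ k / (k.factorial : ℝ) := by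
      have : Real.exp (-l') = c * Real.exp (-l) := by
        rw [hc, ← Real.exp_add]; congr 1; ring
      rw [this]; ring
    rw [he]
    gcongr
  have key : ∀ B : Set ℕ, c * μ.real B ≤ ν.real B := by
    intro B
    have h : ENNReal.ofReal c * μ B ≤ ν B := by
      rw [← Measure.tsum_indicator_apply_singleton μ B (MeasurableSet.of_discrete),
        ← Measure.tsum_indicator_apply_singleton ν B (MeasurableSet.of_discrete),
        ← ENNReal.tsum_mul_left]
      apply ENNReal.tsum_le_tsum
      intro k
      by_cases hk : k ∈ B
      · simpa [hk] using hpt k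
      · simp [hk]
    have h2 := ENNReal.toReal_mono (measure_ne_top ν B) h
    rwa [ENNReal.toReal_mul, ENNReal.toReal_ofReal hc0] at h2
  have hk1 := key A
  have hk2 := key Aᶜ
  rw [probReal_compl_eq_one_sub MeasurableSet.of_discrete,
    probReal_compl_eq_one_sub MeasurableSet.of_discrete] at hk2
  have m0 : 0 ≤ μ.real A := measureReal_nonneg
  have m1 : μ.real A ≤ 1 := measureReal_le_one
  change |μ.real A - ν.real A| ≤ 1 - c
  rw [abs_le]
  constructor <;> nlinarith

/-- Poisson parameter perturbation bound:
`TV(Poi(λ), Poi(λ')) ≤ 1 - e^{-|λ-λ'|} ≤ |λ-λ'|`. -/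
theorem stmt18 (l l' : ℝ) (hl : 0 ≤ l) (hl' : 0 ≤ l')
    (μ ν : Measure ℕ) [IsProbabilityMeasure μ] [IsProbabilityMeasure ν]
    (hμ : ∀ k, μ {k} = ENNReal.ofReal (poisPMF l k))
    (hν : ∀ k, ν {k} = ENNReal.ofReal (poisPMF l' k)) :
    tvDist μ ν ≤ 1 - Real.exp (-|l - l'|)
    ∧ 1 - Real.exp (-|l - l'|) ≤ |l - l'| := by
  refine ⟨?_, ?_⟩
  · unfold tvDist
    haveI : Nonempty {s : Set ℕ // MeasurableSet s} := ⟨⟨∅, MeasurableSet.empty⟩⟩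
    apply ciSup_le
    intro A
    rcases le_total l l' with h | h
    · rw [abs_of_nonpos (sub_nonpos.mpr h), neg_sub l l']
      exact pois_aux l l' hl h μ ν hμ hν A.1
    · rw [abs_of_nonneg (sub_nonneg.mpr h), abs_sub_comm]
      exact pois_aux l' l hl' h ν μ hν hμ A.1
  · have := Real.add_one_le_exp (-|l - l'|)
    linarith
end
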